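/- arXiv:2409.16286 — 4 statements merged into one kernel-verified Lean document; each statement's English description precedes it below -/
import Mathlib

section
/- Let 2 ≤ q < p be real numbers, let X be a Banach space whose modulus of convexity is of power type q, and let I be an infinite set. Then for every ε > 0 there exists η > 0 with the following property: whenever x ∈ S_{ℓ_p(I)} has finite support F ⊆ I and T : ℓ_p(I) → X is a bounded linear operator with ‖T‖ = 1 and ‖T(x)‖ > 1 − η, then ‖T(y)‖ < ε for every y in the closed unit ball of ℓ_p(I) whose support is contained in I \ F. -/
open scoped ENNReal

/-- A Banach space `X` has modulus of convexity of power type `q ≥ 2` if there is `C > 0` such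
that for all `ε ∈ (0,2]` and all `x, y` in the closed unit ball with `‖x - y‖ ≥ ε` one has
`1 - ‖x + y‖/2 ≥ C * ε ^ q`. -/
def HasModulusOfConvexityPowerType (X : Type*) [SeminormedAddCommGroup X] (q : ℝ) : Prop :=
  ∃ C > (0 : ℝ), ∀ ε ∈ Set.Ioc (0 : ℝ) 2, ∀ x y : X,
    ‖x‖ ≤ 1 → ‖y‖ ≤ 1 → ε ≤ ‖x - y‖ → C * ε ^ q ≤ 1 - ‖x + y‖ / 2

/-- The norm of `ℓ_p` is `p`-additive on disjointly supported elements. -/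
theorem lp_norm_rpow_add_of_disjoint {I : Type*} {p : ℝ≥0∞} [Fact (1 ≤ p)] (hp : 0 < p.toReal)
    (x y : lp (fun _ : I => ℝ) p) (h : ∀ i, x i = 0 ∨ y i = 0) :
    ‖x + y‖ ^ p.toReal = ‖x‖ ^ p.toReal + ‖y‖ ^ p.toReal := by
  have hasSum := (lp.hasSum_norm hp x).add (lp.hasSum_norm hp y)
  refine (lp.hasSum_norm hp (x + y)).unique ?_
  convert hasSum using 2 with i
  rcases h i with h | h <;> simp [h, Real.zero_rpow hp.ne']

/-- In a space with modulus of convexity of power type `q`, a perturbation `w` with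
`‖a ± w‖ ≤ r`, `1 ≤ r`, is controlled by how far `‖a‖` is from `r`. -/
theorem HasModulusOfConvexityPowerType.exists_mul_rpow_le {X : Type*} [NormedAddCommGroup X]
    [NormedSpace ℝ X] {q : ℝ} (hq : 0 < q) (hX : HasModulusOfConvexityPowerType X q) :
    ∃ C > (0 : ℝ), ∀ (a w : X) (r : ℝ), 1 ≤ r → r ≤ 2 → ‖a + w‖ ≤ r → ‖a - w‖ ≤ r →
      C * ‖w‖ ^ q ≤ r - ‖a‖ := by
  obtain ⟨C, hC, h⟩ := hX
  refine ⟨C, hC, fun a w r hr hr2 h₁ h₂ => ?_⟩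
  have hr0 : 0 < r := by linarith
  have ha : ‖a‖ ≤ r := by
    have := norm_add_le (a + w) (a - w)
    rw [show (a + w) + (a - w) = (2 : ℝ) • a by rw [two_smul]; abel, norm_smul] at this
    norm_num at this
    linarith
  have hw : ‖w‖ ≤ r := by
    have := norm_sub_le (a + w) (a - w)
    rw [show (a + w) - (a - w) = (2 : ℝ) • w by rw [two_smul]; abel, norm_smul] at this
    norm_num at this
    linarith
  rcases (norm_nonneg w).eq_or_lt with h0 | h0
  · rw [← h0, Real.zero_rpow hq.ne']
    linarith
  have hscale : ∀ b : X, ‖r⁻¹ • b‖ = ‖b‖ / r := fun b => by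
    rw [norm_smul, Real.norm_of_nonneg (by positivity), inv_mul_eq_div]
  have key := h ‖w‖ ⟨h0, hw.trans hr2⟩ (r⁻¹ • (a + w)) (r⁻¹ • (a - w))
    (by rw [hscale]; exact (div_le_one hr0).2 h₁) (by rw [hscale]; exact (div_le_one hr0).2 h₂) (by
      rw [← smul_sub, hscale, show (a + w) - (a - w) = (2 : ℝ) • w by rw [two_smul]; abel,
        norm_smul, le_div_iff₀ hr0]
      norm_num
      nlinarith)
  rw [← smul_add, hscale, show (a + w) + (a - w) = (2 : ℝ) • a by rw [two_smul]; abel,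
    norm_smul] at key
  refine key.trans ?_
  rw [show ‖(2 : ℝ)‖ * ‖a‖ / r / 2 = ‖a‖ / r by norm_num; ring]
  have : ‖a‖ / r * r = ‖a‖ := div_mul_cancel₀ _ hr0.ne'
  have : ‖a‖ / r ≤ 1 := (div_le_one hr0).2 ha
  nlinarith

/-- **Theorem 3.1.** Let `2 ≤ q < p`, let `X` be a Banach space whose modulus of convexity is of
power type `q`, and let `I` be an infinite set. Then for every `ε > 0` there is `η > 0` such that
whenever `x ∈ S_{ℓ_p(I)}` has finite support `F` and `T : ℓ_p(I) → X` is a norm-one bounded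
operator with `‖T x‖ > 1 - η`, then `‖T y‖ < ε` for every `y ∈ B_{ℓ_p(I)}` supported in `I \ F`. -/
theorem lp_operator_small_off_finite_support
    (p q : ℝ) (hq : 2 ≤ q) (hqp : q < p)
    (X : Type*) [NormedAddCommGroup X] [NormedSpace ℝ X] [CompleteSpace X]
    (hX : HasModulusOfConvexityPowerType X q)
    (I : Type*) [Infinite I] [Fact (1 ≤ ENNReal.ofReal p)] :
    ∀ ε > (0 : ℝ), ∃ η > (0 : ℝ),
      ∀ x : lp (fun _ : I => ℝ) (ENNReal.ofReal p), ‖x‖ = 1 →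
        ∀ F : Finset I, Function.support (x : I → ℝ) = ↑F →
          ∀ T : lp (fun _ : I => ℝ) (ENNReal.ofReal p) →L[ℝ] X, ‖T‖ = 1 → 1 - η < ‖T x‖ →
            ∀ y : lp (fun _ : I => ℝ) (ENNReal.ofReal p), ‖y‖ ≤ 1 →
              (∀ i ∈ F, (y : I → ℝ) i = 0) → ‖T y‖ < ε := by
  intro ε hε
  have hp : 0 < p := by linarith
  have hpr : (ENNReal.ofReal p).toReal = p := ENNReal.toReal_ofReal hp.le
  obtain ⟨C, hC, hCX⟩ := hX.exists_mul_rpow_le (by linarith)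
  obtain ⟨t, ht0, ht1, ht⟩ : ∃ t : ℝ, 0 < t ∧ t ≤ 1 ∧ 2 * t ^ (p - q) ≤ C * ε ^ q := by
    have hpos : 0 < C * ε ^ q / 2 := by positivity
    refine ⟨min 1 ((C * ε ^ q / 2) ^ (p - q)⁻¹), by positivity, min_le_left _ _, ?_⟩
    have := Real.rpow_le_rpow (by positivity) (min_le_right 1 ((C * ε ^ q / 2) ^ (p - q)⁻¹))
      (sub_nonneg.2 hqp.le)
    rw [Real.rpow_inv_rpow hpos.le (sub_pos.2 hqp).ne'] at this
    linarith
  have htp : 0 < t ^ p := by positivity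
  refine ⟨t ^ p, htp, fun x hx F hF T hT hTx y hy hyF => ?_⟩
  by_contra! hTy
  have hbound : ∀ s : ℝ, |s| = t → ‖T x + T (s • y)‖ ≤ 1 + t ^ p := fun s hs => by
    rw [← map_add]
    refine (T.le_of_opNorm_le hT.le _).trans ?_
    rw [one_mul]
    have hadd := lp_norm_rpow_add_of_disjoint (by rwa [hpr]) x (s • y) fun i => by
      by_cases hi : i ∈ F
      · exact Or.inr (by simp [hyF i hi])
      · exact Or.inl (Function.notMem_support.1 (by rwa [hF]))
    rw [hpr, hx, Real.one_rpow] at hadd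
    have hsy : ‖s • y‖ ^ p ≤ t ^ p := by
      refine Real.rpow_le_rpow (norm_nonneg _) ?_ hp.le
      rw [norm_smul, Real.norm_eq_abs, hs]
      exact mul_le_of_le_one_right ht0.le hy
    refine (Real.rpow_le_rpow_iff (norm_nonneg _) (by positivity) hp).1 ?_
    rw [hadd]
    exact (add_le_add_right hsy 1).trans (Real.self_le_rpow_of_one_le (by linarith) (by linarith))
  have key := hCX (T x) (T (t • y)) (1 + t ^ p) (by linarith)
    (by linarith [Real.rpow_le_one ht0.le ht1 hp.le]) (hbound t (abs_of_pos ht0))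
    (by simpa [sub_eq_add_neg] using hbound (-t) (by rw [abs_neg, abs_of_pos ht0]))
  rw [map_smul, norm_smul, Real.norm_of_nonneg ht0.le,
    Real.mul_rpow ht0.le (norm_nonneg _)] at key
  have hε_le : ε ^ q ≤ ‖T y‖ ^ q := Real.rpow_le_rpow hε.le hTy (by linarith)
  have htq : 0 < t ^ q := by positivity
  have hsplit : t ^ p = t ^ q * t ^ (p - q) := by rw [← Real.rpow_add ht0]; congr 1; ring
  have h₁ : C * (t ^ q * ε ^ q) ≤ C * (t ^ q * ‖T y‖ ^ q) := by gcongr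
  have h₂ := mul_le_mul_of_nonneg_left ht htq.le
  linarith
end

section
/- Let 2 ≤ q < p be real numbers, let X be a Banach space whose modulus of convexity is of power type q, and let I be an infinite set. Then for every ε > 0 there exists η > 0 such that for every x ∈ S_{ℓ_p(I)} there exists a finite set F ⊆ I with the following property: if T : ℓ_p(I) → X is a bounded linear operator with ‖T‖ = 1 and ‖T(x)‖ > 1 − η, then ‖T(y)‖ < ε for every y in the closed unit ball of ℓ_p(I) whose support is contained in I \ F. -/
open scoped ENNReal

/-- The `p`-th power of the `ℓ_p` norm is additive on disjointly supported elements. -/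
lemma lp_norm_add_rpow_of_disjoint {I : Type*} {r : ℝ≥0∞} (hr : 0 < r.toReal)
    (f g : lp (fun _ : I => ℝ) r) (h : ∀ i, f i = 0 ∨ g i = 0) :
    ‖f + g‖ ^ r.toReal = ‖f‖ ^ r.toReal + ‖g‖ ^ r.toReal := by
  refine (lp.hasSum_norm hr (f + g)).unique ?_
  refine ((lp.hasSum_norm hr f).add (lp.hasSum_norm hr g)).congr_fun ?_
  intro i
  rcases h i with h | h <;> simp [h, Real.zero_rpow hr.ne']

/-- Disjointly supported `u, y` in the unit ball of `ℓ_p` satisfy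
`‖u + t • y‖ ≤ 1 + |t| ^ p`. -/
lemma lp_norm_add_smul_le {I : Type*} {r : ℝ≥0∞} [Fact (1 ≤ r)] (hr : 1 ≤ r.toReal)
    (u y : lp (fun _ : I => ℝ) r) (hu : ‖u‖ ≤ 1) (hy : ‖y‖ ≤ 1)
    (h : ∀ i, u i = 0 ∨ y i = 0) (t : ℝ) :
    ‖u + t • y‖ ≤ 1 + |t| ^ r.toReal := by
  have hr0 : 0 < r.toReal := by linarith
  have h1 : ‖u + t • y‖ ^ r.toReal = ‖u‖ ^ r.toReal + ‖t • y‖ ^ r.toReal :=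
    lp_norm_add_rpow_of_disjoint hr0 _ _ fun i => (h i).imp_right fun hi => by simp [hi]
  have h2 : ‖u‖ ^ r.toReal ≤ 1 := Real.rpow_le_one (norm_nonneg _) hu hr0.le
  have h3 : ‖t • y‖ ^ r.toReal ≤ |t| ^ r.toReal := by
    refine Real.rpow_le_rpow (norm_nonneg _) ?_ hr0.le
    rw [norm_smul, Real.norm_eq_abs]
    exact mul_le_of_le_one_right (abs_nonneg t) hy
  have h4 : 0 ≤ |t| ^ r.toReal := by positivity
  have h5 : (1 + |t| ^ r.toReal) ≤ (1 + |t| ^ r.toReal) ^ r.toReal :=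
    Real.self_le_rpow_of_one_le (by linarith) hr
  exact (Real.rpow_le_rpow_iff (norm_nonneg _) (by linarith) hr0).1 (by linarith)

/-- For `p < ∞`, an element of `ℓ_p` is approximated by finitely supported elements of no larger
norm. -/
lemma exists_finite_support_approx {I : Type*} {r : ℝ≥0∞} [Fact (1 ≤ r)] (hr : r ≠ ⊤)
    (x : lp (fun _ : I => ℝ) r) {δ : ℝ} (hδ : 0 < δ) :
    ∃ F : Finset I, ∃ u : lp (fun _ : I => ℝ) r,
      (∀ i ∉ F, u i = 0) ∧ ‖u‖ ≤ ‖x‖ ∧ ‖x - u‖ < δ := by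
  classical
  have hr0 : 0 < r.toReal :=
    ENNReal.toReal_pos (zero_lt_one.trans_le Fact.out).ne' hr
  obtain ⟨F, hF⟩ := ((lp.hasSum_single hr x).eventually (Metric.ball_mem_nhds x hδ)).exists
  set u : lp (fun _ : I => ℝ) r := ∑ i ∈ F, lp.single r i (x i) with hu
  have hcoe : ∀ i, u i = if i ∈ F then x i else 0 := by
    intro i
    simp only [hu, lp.coeFn_sum, lp.coeFn_single]
    exact (Finset.sum_apply i F _).trans (Finset.sum_pi_single i _ F)
  refine ⟨F, u, fun i hi => by simp [hcoe, hi], ?_, ?_⟩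
  · have h := lp_norm_add_rpow_of_disjoint hr0 u (x - u) fun i => by
      by_cases hi : i ∈ F <;> simp [hcoe, hi]
    rw [add_sub_cancel] at h
    refine (Real.rpow_le_rpow_iff (norm_nonneg _) (norm_nonneg _) hr0).1 ?_
    have : 0 ≤ ‖x - u‖ ^ r.toReal := by positivity
    linarith
  · rw [← dist_eq_norm, dist_comm]
    exact hF

/-- If `q < p`, then `t ^ p` is eventually negligible compared with `t ^ q` as `t → 0⁺`. -/
lemma exists_rpow_lt_mul_rpow {p q c : ℝ} (hqp : q < p) (hc : 0 < c) :
    ∃ t : ℝ, 0 < t ∧ t ≤ 1 ∧ t ^ p < c * t ^ q := by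
  have hpq : 0 < p - q := sub_pos.2 hqp
  refine ⟨(min 1 (c / 2)) ^ (p - q)⁻¹, by positivity,
    Real.rpow_le_one (by positivity) (min_le_left _ _) (by positivity), ?_⟩
  set t := (min 1 (c / 2)) ^ (p - q)⁻¹ with ht
  have ht0 : 0 < t := by positivity
  have h1 : t ^ (p - q) = min 1 (c / 2) := by
    rw [ht, ← Real.rpow_mul (by positivity), inv_mul_cancel₀ hpq.ne', Real.rpow_one]
  have h2 : t ^ (p - q) < c := by
    rw [h1]; exact (min_le_right _ _).trans_lt (by linarith)
  calc t ^ p = t ^ (p - q) * t ^ q := by rw [← Real.rpow_add ht0, sub_add_cancel]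
    _ < c * t ^ q := by gcongr

/-- Scaled form of a power type modulus of convexity: if `v ± w` lie in the ball of radius
`s ∈ [1, 2]` and `d ≤ ‖w‖`, then `C * d ^ q ≤ s - ‖v‖`. -/
lemma modulus_bound_of_norm_add_sub_le {X : Type*} [NormedAddCommGroup X] [NormedSpace ℝ X]
    {q C : ℝ} (hC : 0 < C)
    (hX : ∀ ε ∈ Set.Ioc (0 : ℝ) 2, ∀ x y : X,
      ‖x‖ ≤ 1 → ‖y‖ ≤ 1 → ε ≤ ‖x - y‖ → C * ε ^ q ≤ 1 - ‖x + y‖ / 2)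
    {s d : ℝ} (hs : 1 ≤ s) (hs2 : s ≤ 2) (hd : 0 < d) (hd2 : d ≤ 2) {v w : X}
    (hadd : ‖v + w‖ ≤ s) (hsub : ‖v - w‖ ≤ s) (hw : d ≤ ‖w‖) :
    C * d ^ q ≤ s - ‖v‖ := by
  have hs0 : 0 < s := by linarith
  have hnorm (z : X) : ‖s⁻¹ • z‖ = ‖z‖ / s := by
    rw [norm_smul, Real.norm_of_nonneg (by positivity), inv_mul_eq_div]
  have hdiff : ‖s⁻¹ • (v + w) - s⁻¹ • (v - w)‖ = 2 * ‖w‖ / s := by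
    rw [← smul_sub, hnorm, show v + w - (v - w) = (2 : ℝ) • w by module, norm_smul]
    simp
  have hsum : ‖s⁻¹ • (v + w) + s⁻¹ • (v - w)‖ = 2 * ‖v‖ / s := by
    rw [← smul_add, hnorm, show v + w + (v - w) = (2 : ℝ) • v by module, norm_smul]
    simp
  have key := hX d ⟨hd, hd2⟩ (s⁻¹ • (v + w)) (s⁻¹ • (v - w))
    (by rw [hnorm]; exact div_le_one_of_le₀ hadd hs0.le)
    (by rw [hnorm]; exact div_le_one_of_le₀ hsub hs0.le)
    (by rw [hdiff, le_div_iff₀ hs0]; nlinarith)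
  rw [hsum] at key
  have hpos : 0 ≤ C * d ^ q := by positivity
  calc C * d ^ q ≤ s * (C * d ^ q) := le_mul_of_one_le_left hpos hs
    _ ≤ s * (1 - 2 * ‖v‖ / s / 2) := by gcongr
    _ = s - ‖v‖ := by field_simp

/-- **Corollary 3.2.** Let `2 ≤ q < p`, let `X` be a Banach space whose modulus of convexity is
of power type `q`, and let `I` be an infinite set. Then for every `ε > 0` there exists `η > 0`
such that for every `x ∈ S_{ℓ_p(I)}` there is a finite set `F ⊆ I` with the property that if
`T : ℓ_p(I) → X` is a norm-one bounded operator with `‖T x‖ > 1 - η`, then `‖T y‖ < ε` for every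
`y ∈ B_{ℓ_p(I)}` supported in `I \ F`. -/
theorem lp_operator_small_off_finite_support'
    (p q : ℝ) (hq : 2 ≤ q) (hqp : q < p)
    (X : Type*) [NormedAddCommGroup X] [NormedSpace ℝ X] [CompleteSpace X]
    (hX : HasModulusOfConvexityPowerType X q)
    (I : Type*) [Infinite I] [Fact (1 ≤ ENNReal.ofReal p)] :
    ∀ ε > (0 : ℝ), ∃ η > (0 : ℝ),
      ∀ x : lp (fun _ : I => ℝ) (ENNReal.ofReal p), ‖x‖ = 1 →
        ∃ F : Finset I,
          ∀ T : lp (fun _ : I => ℝ) (ENNReal.ofReal p) →L[ℝ] X, ‖T‖ = 1 → 1 - η < ‖T x‖ →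
            ∀ y : lp (fun _ : I => ℝ) (ENNReal.ofReal p), ‖y‖ ≤ 1 →
              (∀ i ∈ F, (y : I → ℝ) i = 0) → ‖T y‖ < ε := by
  intro ε hε
  obtain ⟨C, hC, hmod⟩ := hX
  have hp0 : 0 ≤ p := by linarith
  have hr : (ENNReal.ofReal p).toReal = p := ENNReal.toReal_ofReal hp0
  obtain ⟨t, ht0, ht1, ht⟩ := exists_rpow_lt_mul_rpow (c := C * ε ^ q / 2) hqp (by positivity)
  have htp : 0 < t ^ p := by positivity
  have htp1 : t ^ p ≤ 1 := Real.rpow_le_one ht0.le ht1 hp0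
  refine ⟨t ^ p / 2, by positivity, fun x hx => ?_⟩
  obtain ⟨F, u, huF, hux, hxu⟩ :=
    exists_finite_support_approx ENNReal.ofReal_ne_top x (half_pos htp)
  refine ⟨F, fun T hT hTx y hy hyF => ?_⟩
  by_contra! hTy
  have hT1 (z : lp (fun _ : I => ℝ) (ENNReal.ofReal p)) : ‖T z‖ ≤ ‖z‖ := by
    simpa [hT] using T.le_opNorm z
  have hdisj (i : I) : u i = 0 ∨ y i = 0 := by
    by_cases hi : i ∈ F
    · exact Or.inr (hyF i hi)
    · exact Or.inl (huF i hi)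
  have hball (a : ℝ) (ha : |a| = t) : ‖T (u + a • y)‖ ≤ 1 + t ^ p := by
    have h := lp_norm_add_smul_le (by rw [hr]; linarith) u y (hux.trans hx.le) hy hdisj a
    rw [hr, ha] at h
    exact (hT1 _).trans h
  have hTu : 1 - t ^ p < ‖T u‖ := by
    have h1 : ‖T x‖ ≤ ‖T u‖ + ‖T (x - u)‖ := by
      simpa using norm_add_le (T u) (T (x - u))
    linarith [hT1 (x - u)]
  have hε1 : ε ≤ 1 := hTy.trans ((hT1 y).trans hy)
  have key : C * (t * ε) ^ q ≤ 1 + t ^ p - ‖T u‖ := by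
    refine modulus_bound_of_norm_add_sub_le hC hmod (w := t • T y) (by linarith) (by linarith)
      (by positivity) (by nlinarith) ?_ ?_ ?_
    · simpa using hball t (abs_of_pos ht0)
    · simpa [sub_eq_add_neg] using hball (-t) (by rw [abs_neg, abs_of_pos ht0])
    · rw [norm_smul, Real.norm_of_nonneg ht0.le]
      gcongr
  rw [Real.mul_rpow ht0.le hε.le] at key
  linarith
end

section
/- Let p > 2, let I be an infinite set, and let Y be a finite-dimensional Banach space such that the dual Y* has modulus of convexity of power type q for some q with 2 ≤ q < p. Then the dual of the projective tensor product ℓ_p(I) ⊗̂_π Y has the w*-Kadec–Klee property. -/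
open scoped ENNReal Topology

/-- The set of all sums `Σ ‖u i‖ * ‖v i‖` over finite representations
`z = Σ u i ⊗ v i` of `z` as a sum of elementary tensors. -/
def projRepSums {X Y Z : Type*} [NormedAddCommGroup X] [NormedSpace ℝ X]
    [NormedAddCommGroup Y] [NormedSpace ℝ Y] [NormedAddCommGroup Z] [NormedSpace ℝ Z]
    (tp : X →ₗ[ℝ] Y →ₗ[ℝ] Z) (z : Z) : Set ℝ :=
  { r | ∃ (k : ℕ) (u : Fin k → X) (v : Fin k → Y),
      z = ∑ i, tp (u i) (v i) ∧ r = ∑ i, ‖u i‖ * ‖v i‖ }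

/-- The Banach space `Z`, together with the bilinear map `tp`, is (an isometric copy of) the
projective tensor product `X ⊗̂_π Y`: the span of the elementary tensors is dense in `Z`, and the
norm of any finite sum of elementary tensors is its projective norm, i.e. the infimum of
`Σ ‖u i‖ * ‖v i‖` over all finite representations. -/
structure IsProjectiveTensorProduct {X Y Z : Type*} [NormedAddCommGroup X] [NormedSpace ℝ X]
    [NormedAddCommGroup Y] [NormedSpace ℝ Y] [NormedAddCommGroup Z] [NormedSpace ℝ Z]
    [CompleteSpace Z] (tp : X →ₗ[ℝ] Y →ₗ[ℝ] Z) : Prop where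
  dense_span : Dense ((Submodule.span ℝ (Set.range fun xy : X × Y => tp xy.1 xy.2) : Submodule ℝ Z) : Set Z)
  norm_eq : ∀ (k : ℕ) (u : Fin k → X) (v : Fin k → Y),
    ‖∑ i, tp (u i) (v i)‖ = sInf (projRepSums tp (∑ i, tp (u i) (v i)))

/-- The dual of `Z` has the `w*`-Kadec–Klee property: every net in the unit sphere of `Z*`
converging weak* to an element of the unit sphere converges to it in norm. -/
def WStarKadecKlee (Z : Type*) [NormedAddCommGroup Z] [NormedSpace ℝ Z] : Prop :=
  ∀ {ι : Type*} (l : Filter ι) [l.NeBot] (φ : ι → Z →L[ℝ] ℝ) (f : Z →L[ℝ] ℝ),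
    (∀ s, ‖φ s‖ = 1) → ‖f‖ = 1 →
    (∀ z : Z, Filter.Tendsto (fun s => φ s z) l (𝓝 (f z))) →
    Filter.Tendsto (fun s => ‖φ s - f‖) l (𝓝 0)

section ProjectiveTensorProduct

variable {X Y Z : Type*} [NormedAddCommGroup X] [NormedSpace ℝ X]
  [NormedAddCommGroup Y] [NormedSpace ℝ Y] [NormedAddCommGroup Z] [NormedSpace ℝ Z]
  [CompleteSpace Z] {tp : X →ₗ[ℝ] Y →ₗ[ℝ] Z}

lemma IsProjectiveTensorProduct.norm_apply_le (htp : IsProjectiveTensorProduct tp) (x : X) (y : Y) :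
    ‖tp x y‖ ≤ ‖x‖ * ‖y‖ := by
  have h := htp.norm_eq 1 (fun _ => x) (fun _ => y)
  simp only [Finset.univ_unique, Finset.sum_const, Finset.card_singleton, one_smul] at h
  rw [h]
  refine csInf_le ⟨0, ?_⟩ ⟨1, fun _ => x, fun _ => y, by simp, by simp⟩
  rintro r ⟨k, u, v, -, rfl⟩
  positivity

lemma IsProjectiveTensorProduct.norm_functional_le (htp : IsProjectiveTensorProduct tp)
    (φ : Z →L[ℝ] ℝ) {M : ℝ} (hM : 0 ≤ M) (h : ∀ x y, ‖φ (tp x y)‖ ≤ M * (‖x‖ * ‖y‖)) :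
    ‖φ‖ ≤ M := by
  refine φ.opNorm_le_bound hM fun z => ?_
  have hcl : IsClosed {z : Z | ‖φ z‖ ≤ M * ‖z‖} :=
    isClosed_le (by fun_prop) (by fun_prop)
  refine (hcl.closure_subset_iff.2 ?_) (htp.dense_span z)
  intro z hz
  obtain ⟨n, c, g, rfl⟩ := Submodule.mem_span_set'.1 hz
  choose w hw using fun i => (g i).2
  have hsum : ∑ i, c i • (g i : Z) = ∑ i, tp (c i • (w i).1) (w i).2 := by
    refine Finset.sum_congr rfl fun i _ => ?_
    simp [← hw i]
  rw [hsum, Set.mem_ofPred_eq, htp.norm_eq]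
  set z := ∑ i, tp (c i • (w i).1) (w i).2 with hzdef
  have hbound : ∀ r ∈ projRepSums tp z, ‖φ z‖ ≤ M * r := by
    rintro r ⟨k, u, v, hz, rfl⟩
    rw [hz, map_sum, Finset.mul_sum]
    exact (norm_sum_le _ _).trans (Finset.sum_le_sum fun i _ => h _ _)
  have hne : (projRepSums tp z).Nonempty := ⟨_, n, _, _, hzdef, rfl⟩
  rcases hM.eq_or_lt with rfl | hM
  · obtain ⟨r, hr⟩ := hne
    simpa using hbound r hr
  · rw [← div_le_iff₀' hM]
    exact le_csInf hne fun r hr => (div_le_iff₀' hM).2 (hbound r hr)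

/-- The operator `X → Y*` induced by a functional on a projective tensor product. -/
noncomputable def IsProjectiveTensorProduct.toOperator (htp : IsProjectiveTensorProduct tp)
    (φ : Z →L[ℝ] ℝ) : X →L[ℝ] Y →L[ℝ] ℝ :=
  (ContinuousLinearMap.compL ℝ Y Z ℝ φ).comp
    (tp.mkContinuous₂ 1 fun x y => by simpa using htp.norm_apply_le x y)

@[simp]
lemma IsProjectiveTensorProduct.toOperator_apply (htp : IsProjectiveTensorProduct tp)
    (φ : Z →L[ℝ] ℝ) (x : X) (y : Y) : htp.toOperator φ x y = φ (tp x y) := rfl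

lemma IsProjectiveTensorProduct.norm_toOperator (htp : IsProjectiveTensorProduct tp)
    (φ : Z →L[ℝ] ℝ) : ‖htp.toOperator φ‖ = ‖φ‖ := by
  refine le_antisymm (ContinuousLinearMap.opNorm_le_bound₂ _ (norm_nonneg _) fun x y => ?_)
    (htp.norm_functional_le φ (norm_nonneg (htp.toOperator φ)) fun x y => ?_)
  · rw [htp.toOperator_apply, mul_assoc]
    exact (φ.le_opNorm _).trans (by gcongr; exact htp.norm_apply_le x y)
  · rw [← htp.toOperator_apply, ← mul_assoc]
    exact (htp.toOperator φ).le_opNorm₂ x y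

lemma IsProjectiveTensorProduct.toOperator_sub (htp : IsProjectiveTensorProduct tp)
    (φ ψ : Z →L[ℝ] ℝ) : htp.toOperator (φ - ψ) = htp.toOperator φ - htp.toOperator ψ := by
  ext x y
  simp

end ProjectiveTensorProduct

/-- On the dual of a finite-dimensional space, pointwise convergence is norm convergence. -/
lemma tendsto_dual_of_forall_tendsto_apply {Y ι : Type*} [NormedAddCommGroup Y] [NormedSpace ℝ Y]
    [FiniteDimensional ℝ Y] {l : Filter ι} {g : ι → Y →L[ℝ] ℝ} {g₀ : Y →L[ℝ] ℝ}
    (h : ∀ y, Filter.Tendsto (fun s => g s y) l (𝓝 (g₀ y))) : Filter.Tendsto g l (𝓝 g₀) := by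
  let L : (Y →L[ℝ] ℝ) →ₗ[ℝ] (Y → ℝ) :=
    { toFun := fun g y => g y
      map_add' := fun _ _ => rfl
      map_smul' := fun _ _ => rfl }
  have hL : LinearMap.ker L = ⊥ :=
    LinearMap.ker_eq_bot.2 fun a b hab => ContinuousLinearMap.ext fun y => congrFun hab y
  exact (LinearMap.isClosedEmbedding_of_injective hL).isEmbedding.tendsto_nhds_iff.2
    (tendsto_pi_nhds.2 h)

section DisjointSupport

variable {I : Type*} {P : ℝ≥0∞}

/-- The coordinate projection of `ℓ_P(I)` onto a finite set of coordinates. -/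
noncomputable def lpFinsetProj (F : Finset I) (f : lp (fun _ : I => ℝ) P) :
    lp (fun _ : I => ℝ) P :=
  open Classical in ∑ i ∈ F, lp.single P i (f i)

lemma lpFinsetProj_apply_of_mem (F : Finset I) (f : lp (fun _ : I => ℝ) P) {i : I} (hi : i ∈ F) :
    lpFinsetProj F f i = f i := by
  classical
  simp only [lpFinsetProj, lp.coeFn_sum, lp.coeFn_single, Finset.sum_apply, Finset.sum_pi_single,
    if_pos hi]

lemma lpFinsetProj_congr (F : Finset I) {f g : lp (fun _ : I => ℝ) P} (h : ∀ i ∈ F, f i = g i) :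
    lpFinsetProj F f = lpFinsetProj F g := by
  classical
  exact Finset.sum_congr rfl fun i hi => by rw [h i hi]

lemma norm_rpow_eq_norm_lpFinsetProj_add (hP : 0 < P.toReal) (F : Finset I)
    (f : lp (fun _ : I => ℝ) P) :
    ‖f‖ ^ P.toReal = ‖lpFinsetProj F f‖ ^ P.toReal + ‖f - lpFinsetProj F f‖ ^ P.toReal := by
  classical
  have h₁ := lp.norm_sub_norm_compl_sub_single hP f F
  have h₂ := lp.norm_sum_single hP (fun i => f i) F
  simp only [lpFinsetProj]
  linarith

variable [Fact (1 ≤ P)]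

lemma norm_lpFinsetProj_le (hP : 0 < P.toReal) (F : Finset I) (f : lp (fun _ : I => ℝ) P) :
    ‖lpFinsetProj F f‖ ≤ ‖f‖ := by
  rw [← Real.rpow_le_rpow_iff (norm_nonneg _) (norm_nonneg _) hP,
    norm_rpow_eq_norm_lpFinsetProj_add hP F f]
  have : 0 ≤ ‖f - lpFinsetProj F f‖ ^ P.toReal := by positivity
  linarith

lemma norm_sub_lpFinsetProj_le (hP : 0 < P.toReal) (F : Finset I) (f : lp (fun _ : I => ℝ) P) :
    ‖f - lpFinsetProj F f‖ ≤ ‖f‖ := by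
  rw [← Real.rpow_le_rpow_iff (norm_nonneg _) (norm_nonneg _) hP,
    norm_rpow_eq_norm_lpFinsetProj_add hP F f]
  have : 0 ≤ ‖lpFinsetProj F f‖ ^ P.toReal := by positivity
  linarith

lemma norm_lpFinsetProj_add_smul_rpow (hP : 0 < P.toReal) (F : Finset I)
    (x y : lp (fun _ : I => ℝ) P) (hy : ∀ i ∈ F, y i = 0) (c : ℝ) :
    ‖lpFinsetProj F x + c • y‖ ^ P.toReal =
      ‖lpFinsetProj F x‖ ^ P.toReal + (|c| * ‖y‖) ^ P.toReal := by
  have h : lpFinsetProj F (lpFinsetProj F x + c • y) = lpFinsetProj F x :=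
    lpFinsetProj_congr F fun i hi => by
      change lpFinsetProj F x i + c * y i = x i
      rw [lpFinsetProj_apply_of_mem F x hi, hy i hi, mul_zero, add_zero]
  rw [norm_rpow_eq_norm_lpFinsetProj_add hP F, h, add_sub_cancel_left, norm_smul, Real.norm_eq_abs]

end DisjointSupport

/-- If `E` has modulus of convexity of power type `q < p`, a strong limit of contractions
`ℓ_p(I) → E` preserving norm one forces the tails of the operators to be uniformly small. -/
lemma exists_finset_eventually_norm_apply_le {I E ι : Type*} {P : ℝ≥0∞} [Fact (1 ≤ P)]
    (hPtop : P ≠ ⊤) [NormedAddCommGroup E] [NormedSpace ℝ E] {q : ℝ} (hq : 0 < q)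
    (hqP : q < P.toReal) (hE : HasModulusOfConvexityPowerType E q) {l : Filter ι}
    {T : ι → lp (fun _ : I => ℝ) P →L[ℝ] E} {T₀ : lp (fun _ : I => ℝ) P →L[ℝ] E}
    (hT : ∀ s, ‖T s‖ ≤ 1) (hT₀ : ‖T₀‖ = 1)
    (hlim : ∀ x, Filter.Tendsto (fun s => T s x) l (𝓝 (T₀ x))) {ε : ℝ} (hε : 0 < ε) :
    ∃ F : Finset I, ∀ᶠ s in l, ∀ y : lp (fun _ : I => ℝ) P, (∀ i ∈ F, y i = 0) →
      ‖T s y‖ ≤ ε * ‖y‖ := by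
  have hP : 0 < P.toReal := hq.trans hqP
  have hP1 : 1 ≤ P.toReal := by
    simpa using (ENNReal.toReal_le_toReal ENNReal.one_ne_top hPtop).2 (Fact.out : 1 ≤ P)
  obtain ⟨C, hC, hconv⟩ := hE
  obtain ⟨t, ht0, ht1, htε, ht⟩ : ∃ t : ℝ, 0 < t ∧ t ≤ 1 ∧ t * ε ≤ 2 ∧
      t ^ P.toReal < C * (t * ε) ^ q / 2 := by
    have h1 : Filter.Tendsto (fun t : ℝ => t ^ (P.toReal - q)) (𝓝[>] 0) (𝓝 0) := by
      have := (Real.continuousAt_rpow_const 0 (P.toReal - q) (Or.inr (by linarith))).tendsto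
      rw [Real.zero_rpow (by linarith)] at this
      exact this.mono_left nhdsWithin_le_nhds
    have h2 : Filter.Tendsto (fun t : ℝ => t * ε) (𝓝[>] 0) (𝓝 0) := by
      have : Filter.Tendsto (fun t : ℝ => t * ε) (𝓝 0) (𝓝 (0 * ε)) :=
        (continuous_id.mul continuous_const).tendsto _
      rw [zero_mul] at this
      exact this.mono_left nhdsWithin_le_nhds
    have hpos : 0 < C * ε ^ q / 2 := by positivity
    obtain ⟨t, ⟨ha, hb⟩, hc, hd⟩ := ((h1.eventually_lt_const hpos).and
      (h2.eventually_lt_const two_pos)).and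
      (Ioc_mem_nhdsGT (zero_lt_one' ℝ)) |>.exists
    refine ⟨t, hc, hd, hb.le, ?_⟩
    have htq : 0 < t ^ q := Real.rpow_pos_of_pos hc q
    rw [Real.rpow_sub hc, div_lt_iff₀ htq] at ha
    rw [Real.mul_rpow hc.le hε.le]
    linarith
  set δ := C * (t * ε) ^ q / 2 with hδ
  have hδ0 : 0 < δ := by positivity
  obtain ⟨x, hx1, hx⟩ := T₀.exists_lt_apply_of_lt_opNorm (r := 1 - δ) (by linarith)
  obtain ⟨F, hF⟩ : ∃ F : Finset I, 1 - δ < ‖T₀ (lpFinsetProj F x)‖ := by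
    classical
    have h : Filter.Tendsto (fun F => lpFinsetProj F x) Filter.atTop (𝓝 x) := by
      convert! lp.hasSum_single hPtop x
    have h' := ((T₀.continuous.norm.tendsto x).comp h).eventually_const_lt hx
    exact h'.exists
  refine ⟨F, ?_⟩
  have hev := ((hlim (lpFinsetProj F x)).norm).eventually_const_lt hF
  filter_upwards [hev] with s hs y hy
  by_contra! hlt
  have hynorm : 0 < ‖y‖ := by
    rw [norm_pos_iff]
    rintro rfl
    simp at hlt
  set x' := lpFinsetProj F x with hx'
  set c := t / ‖y‖ with hc
  have hc0 : 0 < c := by positivity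
  have hcy : c * ‖y‖ = t := by rw [hc]; field_simp
  set m := (1 + t ^ P.toReal) ^ (1 / P.toReal) with hm
  have htP : 0 < t ^ P.toReal := Real.rpow_pos_of_pos ht0 _
  have hm1 : 1 ≤ m := Real.one_le_rpow (by linarith) (by positivity)
  have hm0 : 0 < m := by linarith
  have hm2 : m ≤ 1 + t ^ P.toReal := by
    have := Real.rpow_le_rpow_of_exponent_le (x := 1 + t ^ P.toReal) (by linarith)
      (show 1 / P.toReal ≤ 1 by rw [div_le_one hP]; exact hP1)
    simpa [hm] using this
  have hm3 : m ≤ 2 := by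
    have := Real.rpow_le_one ht0.le ht1 hP.le
    linarith
  have hx'1 : ‖x'‖ ≤ 1 := (norm_lpFinsetProj_le hP F x).trans hx1.le
  have key : ∀ d : ℝ, |d| = c → ‖T s (x' + d • y)‖ ≤ m := by
    intro d hd
    refine ((T s).le_of_opNorm_le (hT s) _).trans ?_
    rw [one_mul, hm, one_div, Real.le_rpow_inv_iff_of_pos (norm_nonneg _) (by positivity) hP,
      norm_lpFinsetProj_add_smul_rpow hP F x y hy d, hd, hcy]
    gcongr
    exact Real.rpow_le_one (norm_nonneg _) hx'1 hP.le
  have hscale : ∀ d : ℝ, |d| = c → ‖m⁻¹ • T s (x' + d • y)‖ ≤ 1 := fun d hd => by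
    rw [norm_smul, Real.norm_of_nonneg (by positivity), inv_mul_le_one₀ hm0]
    exact key d hd
  have hdiff : t * ε ≤ ‖m⁻¹ • T s (x' + c • y) - m⁻¹ • T s (x' + (-c) • y)‖ := by
    have : m⁻¹ • T s (x' + c • y) - m⁻¹ • T s (x' + (-c) • y) = (m⁻¹ * (2 * c)) • T s y := by
      simp only [map_add, map_smul]
      module
    rw [this, norm_smul, Real.norm_of_nonneg (by positivity), mul_assoc, le_inv_mul_iff₀ hm0]
    have h1 : c * (ε * ‖y‖) ≤ c * ‖T s y‖ := by gcongr
    have h2 : c * (ε * ‖y‖) = t * ε := by rw [← hcy]; ring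
    have h3 : m * (t * ε) ≤ 2 * (t * ε) := by gcongr
    linarith
  have hsum : m⁻¹ • T s (x' + c • y) + m⁻¹ • T s (x' + (-c) • y) = (m⁻¹ * 2) • T s x' := by
    simp only [map_add, map_smul]
    module
  have hfin := hconv (t * ε) ⟨by positivity, htε⟩ _ _ (hscale c (abs_of_pos hc0))
    (hscale (-c) (by rw [abs_neg, abs_of_pos hc0])) hdiff
  rw [hsum, norm_smul, Real.norm_of_nonneg (by positivity)] at hfin
  have hCδ : C * (t * ε) ^ q = 2 * δ := by rw [hδ]; ring
  have hfin' : m⁻¹ * ‖T s x'‖ ≤ 1 - 2 * δ := by linarith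
  rw [inv_mul_le_iff₀ hm0] at hfin'
  nlinarith [mul_le_mul_of_nonneg_left hm1 hδ0.le]

/-- If `E` has modulus of convexity of power type `q < p`, strong convergence of norm-one operators
`ℓ_p(I) → E` to a norm-one operator is norm convergence. -/
theorem tendsto_norm_sub_of_strongly_tendsto {I E ι : Type*} {P : ℝ≥0∞} [Fact (1 ≤ P)]
    (hPtop : P ≠ ⊤) [NormedAddCommGroup E] [NormedSpace ℝ E] {q : ℝ} (hq : 0 < q)
    (hqP : q < P.toReal) (hE : HasModulusOfConvexityPowerType E q) {l : Filter ι} [l.NeBot]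
    {T : ι → lp (fun _ : I => ℝ) P →L[ℝ] E} {T₀ : lp (fun _ : I => ℝ) P →L[ℝ] E}
    (hT : ∀ s, ‖T s‖ ≤ 1) (hT₀ : ‖T₀‖ = 1)
    (hlim : ∀ x, Filter.Tendsto (fun s => T s x) l (𝓝 (T₀ x))) :
    Filter.Tendsto (fun s => ‖T s - T₀‖) l (𝓝 0) := by
  classical
  have hP : 0 < P.toReal := hq.trans hqP
  have hP0 : 0 < P := ENNReal.toReal_pos_iff.1 hP |>.1
  rw [Metric.tendsto_nhds]
  intro η hη
  obtain ⟨F, hF⟩ := exists_finset_eventually_norm_apply_le hPtop hq hqP hE hT hT₀ hlim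
    (ε := η / 4) (by positivity)
  have hF₀ : ∀ y : lp (fun _ : I => ℝ) P, (∀ i ∈ F, y i = 0) → ‖T₀ y‖ ≤ η / 4 * ‖y‖ :=
    fun y hy => le_of_tendsto (hlim y).norm (hF.mono fun s hs => hs y hy)
  have hcoord : Filter.Tendsto
      (fun s => ∑ i ∈ F, ‖T s (lp.single P i (1 : ℝ)) - T₀ (lp.single P i (1 : ℝ))‖) l (𝓝 0) := by
    have := tendsto_finsetSum F fun i _ =>
      ((hlim (lp.single P i (1 : ℝ))).sub_const (T₀ (lp.single P i (1 : ℝ)))).norm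
    simpa using this
  filter_upwards [hF, hcoord.eventually_lt_const (show 0 < η / 4 by positivity)] with s hs hsum
  rw [dist_zero_right, norm_norm]
  refine lt_of_le_of_lt ((T s - T₀).opNorm_le_bound (M := 3 * η / 4) (by positivity) fun z => ?_)
    (by linarith)
  have htail : ∀ i ∈ F, (z - lpFinsetProj F z) i = 0 := fun i hi => by
    change z i - lpFinsetProj F z i = 0
    rw [lpFinsetProj_apply_of_mem F z hi, sub_self]
  have hle := norm_sub_lpFinsetProj_le hP F z
  have h1 : ‖T s (z - lpFinsetProj F z)‖ ≤ η / 4 * ‖z‖ := (hs _ htail).trans (by gcongr)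
  have h2 : ‖T₀ (z - lpFinsetProj F z)‖ ≤ η / 4 * ‖z‖ := (hF₀ _ htail).trans (by gcongr)
  have h3 : ‖(T s - T₀) (lpFinsetProj F z)‖ ≤ η / 4 * ‖z‖ := by
    have hexp : (T s - T₀) (lpFinsetProj F z) =
        ∑ i ∈ F, z i • (T s (lp.single P i (1 : ℝ)) - T₀ (lp.single P i (1 : ℝ))) := by
      simp only [lpFinsetProj, map_sum]
      refine Finset.sum_congr rfl fun i _ => ?_
      have : (lp.single P i (z i) : lp (fun _ : I => ℝ) P) = z i • lp.single P i (1 : ℝ) := by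
        rw [← lp.single_smul, smul_eq_mul, mul_one]
      rw [← sub_apply, ← map_smul, ← this]
    rw [hexp]
    calc _ ≤ ∑ i ∈ F, ‖z‖ * ‖T s (lp.single P i (1 : ℝ)) - T₀ (lp.single P i (1 : ℝ))‖ := by
          refine (norm_sum_le _ _).trans (Finset.sum_le_sum fun i _ => ?_)
          rw [norm_smul]
          gcongr
          exact lp.norm_apply_le_norm hP0.ne' z i
      _ = (∑ i ∈ F, ‖T s (lp.single P i (1 : ℝ)) - T₀ (lp.single P i (1 : ℝ))‖) * ‖z‖ := by
          rw [← Finset.mul_sum, mul_comm]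
      _ ≤ η / 4 * ‖z‖ := by gcongr
  have hdecomp : (T s - T₀) z = (T s - T₀) (lpFinsetProj F z) +
      (T s (z - lpFinsetProj F z) - T₀ (z - lpFinsetProj F z)) := by
    rw [← sub_apply, ← map_add, add_sub_cancel]
  rw [hdecomp]
  have h4 := norm_add_le ((T s - T₀) (lpFinsetProj F z))
    (T s (z - lpFinsetProj F z) - T₀ (z - lpFinsetProj F z))
  have h5 := norm_sub_le (T s (z - lpFinsetProj F z)) (T₀ (z - lpFinsetProj F z))
  linarith

/-- **Theorem 3.3** (second statement). Let `p > 2`, let `I` be an infinite set and let `Y` be a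
finite-dimensional Banach space whose dual has modulus of convexity of power type `q` for some
`2 ≤ q < p`. Then `(ℓ_p(I) ⊗̂_π Y)*` has the `w*`-Kadec–Klee property. -/
theorem wstarKadecKlee_of_projectiveTensorProduct_lp
    (p q : ℝ) (hp : 2 < p) (hq : 2 ≤ q) (hqp : q < p)
    (I : Type*) [Infinite I] [Fact (1 ≤ ENNReal.ofReal p)]
    (Y : Type*) [NormedAddCommGroup Y] [NormedSpace ℝ Y] [FiniteDimensional ℝ Y]
    (hY : HasModulusOfConvexityPowerType (Y →L[ℝ] ℝ) q)
    (Z : Type*) [NormedAddCommGroup Z] [NormedSpace ℝ Z] [CompleteSpace Z]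
    (tp : lp (fun _ : I => ℝ) (ENNReal.ofReal p) →ₗ[ℝ] Y →ₗ[ℝ] Z)
    (htp : IsProjectiveTensorProduct tp) :
    WStarKadecKlee Z := by
  have hPr : (ENNReal.ofReal p).toReal = p := ENNReal.toReal_ofReal (by linarith)
  intro ι l _ φ f hφ hf hlim
  have h := tendsto_norm_sub_of_strongly_tendsto (l := l) (T := fun s => htp.toOperator (φ s))
    (T₀ := htp.toOperator f) ENNReal.ofReal_ne_top (by linarith) (by rwa [hPr]) hY
    (fun s => by rw [htp.norm_toOperator, hφ s]) (by rw [htp.norm_toOperator, hf])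
    (fun x => tendsto_dual_of_forall_tendsto_apply fun y => hlim (tp x y))
  simpa only [← htp.toOperator_sub, htp.norm_toOperator] using h
end

section
/- Let I be an infinite set and let X be a uniformly convex Banach space. Then for every ε > 0 there exists η > 0 with the following property: whenever x ∈ S_{c_0(I)} has finite support F ⊆ I and T : c_0(I) → X is a bounded linear operator with ‖T‖ = 1 and ‖T(x)‖ > 1 − η, then ‖T(y)‖ < ε for every y in the closed unit ball of c_0(I) whose support is contained in I \ F. -/
open ZeroAtInftyContinuousMap

/-- A function in `C₀(I, ℝ)` has norm at most `C` if it is pointwise bounded by `C`. -/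
theorem ZeroAtInftyContinuousMap.norm_le_of_forall_norm_le {I : Type*} [TopologicalSpace I]
    {f : ZeroAtInftyContinuousMap I ℝ} {C : ℝ} (hC : 0 ≤ C) (h : ∀ i, ‖f i‖ ≤ C) : ‖f‖ ≤ C := by
  rw [← norm_toBCF_eq_norm]
  exact (BoundedContinuousFunction.norm_le hC).2 h

theorem ZeroAtInftyContinuousMap.norm_apply_le {I : Type*} [TopologicalSpace I]
    (f : ZeroAtInftyContinuousMap I ℝ) (i : I) : ‖f i‖ ≤ ‖f‖ := by
  rw [← norm_toBCF_eq_norm]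
  exact f.toBCF.norm_coe_le_norm i

/-- The sum of two elements of the unit ball of `C₀(I, ℝ)` with disjoint supports lies in the
unit ball. -/
theorem ZeroAtInftyContinuousMap.norm_add_le_one_of_disjoint {I : Type*} [TopologicalSpace I]
    {f g : ZeroAtInftyContinuousMap I ℝ} (hf : ‖f‖ ≤ 1) (hg : ‖g‖ ≤ 1)
    (h : ∀ i, f i = 0 ∨ g i = 0) : ‖f + g‖ ≤ 1 := by
  refine norm_le_of_forall_norm_le zero_le_one fun i => ?_
  rw [add_apply]
  rcases h i with hi | hi
  · simpa only [hi, zero_add] using (norm_apply_le g i).trans hg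
  · simpa only [hi, add_zero] using (norm_apply_le f i).trans hf

/-- **Lemma 3.5.** Let `I` be an infinite (discrete) set and let `X` be a uniformly convex Banach
space. Then for every `ε > 0` there is `η > 0` such that whenever `x ∈ S_{c₀(I)}` has finite
support `F` and `T : c₀(I) → X` is a norm-one bounded operator with `‖T x‖ > 1 - η`, then
`‖T y‖ < ε` for every `y ∈ B_{c₀(I)}` supported in `I \ F`. -/
theorem c0_operator_small_off_finite_support
    (I : Type*) [TopologicalSpace I] [DiscreteTopology I] [Infinite I]
    (X : Type*) [NormedAddCommGroup X] [NormedSpace ℝ X] [CompleteSpace X]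
    [UniformConvexSpace X] :
    ∀ ε > (0 : ℝ), ∃ η > (0 : ℝ),
      ∀ x : ZeroAtInftyContinuousMap I ℝ, ‖x‖ = 1 →
        ∀ F : Finset I, Function.support (x : I → ℝ) = ↑F →
          ∀ T : ZeroAtInftyContinuousMap I ℝ →L[ℝ] X, ‖T‖ = 1 → 1 - η < ‖T x‖ →
            ∀ y : ZeroAtInftyContinuousMap I ℝ, ‖y‖ ≤ 1 →
              (∀ i ∈ F, (y : I → ℝ) i = 0) → ‖T y‖ < ε := by
  intro ε hε
  obtain ⟨δ, hδ, hX⟩ := exists_forall_closed_ball_dist_add_le_two_sub X hε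
  refine ⟨δ / 2, half_pos hδ, fun x hx F hF T hT hTx y hy hyF => ?_⟩
  have hdisj (i : I) : x i = 0 ∨ y i = 0 := by
    by_cases hi : i ∈ F
    · exact Or.inr (hyF i hi)
    · refine Or.inl (Function.notMem_support.1 ?_)
      rwa [hF, Finset.mem_coe]
  have hadd : ‖x + y‖ ≤ 1 := norm_add_le_one_of_disjoint hx.le hy hdisj
  have hsub : ‖x - y‖ ≤ 1 := by
    rw [sub_eq_add_neg]
    exact norm_add_le_one_of_disjoint hx.le (by rwa [norm_neg])
      fun i => (hdisj i).imp_right fun h => by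
        rw [ZeroAtInftyContinuousMap.neg_apply, h, neg_zero]
  by_contra! hTy
  have hle : ∀ {z}, ‖z‖ ≤ 1 → ‖T z‖ ≤ 1 := fun hz => (T.unit_le_opNorm _ hz).trans hT.le
  have hdiff : T (x + y) - T (x - y) = (2 : ℝ) • T y := by
    rw [map_add, map_sub, two_smul]; abel
  have hsum : T (x + y) + T (x - y) = (2 : ℝ) • T x := by
    rw [map_add, map_sub, two_smul]; abel
  have key := hX (hle hadd) (hle hsub) (by
    rw [hdiff, norm_smul, Real.norm_two]; linarith)
  rw [hsum, norm_smul, Real.norm_two] at key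
  linarith
end
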